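/- arXiv:1103.1721 — 3 statements merged into one kernel-verified Lean document; each statement's English description precedes it below -/
import Mathlib

section
/- The restriction map P ↦ P|_M is a bijection from ℂ[V]^{W₀,τ} onto ℂ[M]^{W₀}, the algebra of W₀-invariant polynomial functions on M (note that W₀ preserves M = ker μ since μ∘w = μ for all w ∈ W₀). -/
namespace PolyFunStmt

variable (V : Type*) [AddCommGroup V] [Module ℂ V]

/-- The algebra `ℂ[V]` of polynomial functions on `V`: the `ℂ`-subalgebra of the
functions `V → ℂ` generated by the linear forms on `V`. -/
noncomputable def polyFuns : Subalgebra ℂ (V → ℂ) :=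
  Algebra.adjoin ℂ {f : V → ℂ | ∃ φ : V →ₗ[ℂ] ℂ, ⇑φ = f}

variable {V}

/-- The set `ℂ[V]^{W₀}` of `W₀`-invariant polynomial functions on `V`, where
`w ∈ W₀ ⊆ GL(V)` acts on `P` by `(w·P)(v) = P(w⁻¹ v)`. -/
def invPolyFuns (W₀ : Subgroup (Module.End ℂ V)ˣ) : Set (V → ℂ) :=
  {P | P ∈ polyFuns V ∧
    ∀ w ∈ W₀, ∀ v : V, P (((w⁻¹ : (Module.End ℂ V)ˣ) : Module.End ℂ V) v) = P v}

/-- The set `ℂ[V]^{W₀,τ}` of polynomial functions invariant under both `W₀` and the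
translation automorphism `(τP)(v) = P(v − l₀)`. -/
def tauInvPolyFuns (W₀ : Subgroup (Module.End ℂ V)ˣ) (l₀ : V) : Set (V → ℂ) :=
  {P | P ∈ invPolyFuns W₀ ∧ ∀ v : V, P (v - l₀) = P v}

/-- The set `I(M)` of `W₀`-invariant polynomial functions vanishing identically on
`M = ker μ`. -/
def vanishingOnKer (W₀ : Subgroup (Module.End ℂ V)ˣ) (μ : V →ₗ[ℂ] ℂ) : Set (V → ℂ) :=
  {P | P ∈ invPolyFuns W₀ ∧ ∀ v : V, μ v = 0 → P v = 0}

/-- Polynomial functions pull back to polynomial functions along linear maps. -/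
theorem polyFuns_comp_linearMap {V W : Type*} [AddCommGroup V] [Module ℂ V]
    [AddCommGroup W] [Module ℂ W] (f : V →ₗ[ℂ] W) {P : W → ℂ} (hP : P ∈ polyFuns W) :
    P ∘ f ∈ polyFuns V := by
  unfold polyFuns at hP
  induction hP using Algebra.adjoin_induction with
  | mem P hP =>
    obtain ⟨φ, rfl⟩ := hP
    exact Algebra.subset_adjoin ⟨φ.comp f, rfl⟩
  | algebraMap c => exact (polyFuns V).algebraMap_mem c
  | add P Q _ _ hP hQ => exact (polyFuns V).add_mem hP hQ
  | mul P Q _ _ hP hQ => exact (polyFuns V).mul_mem hP hQ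

/-- The restriction of a polynomial function to an affine line is a polynomial. -/
theorem exists_polynomial_eval_line {V : Type*} [AddCommGroup V] [Module ℂ V]
    {P : V → ℂ} (hP : P ∈ polyFuns V) (v x : V) :
    ∃ p : Polynomial ℂ, ∀ t : ℂ, P (v + t • x) = p.eval t := by
  unfold polyFuns at hP
  induction hP using Algebra.adjoin_induction with
  | mem P hP =>
    obtain ⟨φ, rfl⟩ := hP
    refine ⟨Polynomial.C (φ v) + Polynomial.C (φ x) * Polynomial.X, fun t => ?_⟩
    simp [mul_comm t]
  | algebraMap c => exact ⟨Polynomial.C c, fun t => by simp⟩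
  | add P Q _ _ hP hQ =>
    obtain ⟨p, hp⟩ := hP
    obtain ⟨q, hq⟩ := hQ
    exact ⟨p + q, fun t => by simp [hp, hq]⟩
  | mul P Q _ _ hP hQ =>
    obtain ⟨p, hp⟩ := hP
    obtain ⟨q, hq⟩ := hQ
    exact ⟨p * q, fun t => by simp [hp, hq]⟩

/-- A polynomial function invariant under translation by a vector is constant along every line
in the direction of that vector. -/
theorem polyFuns_add_smul_of_sub_invariant {V : Type*} [AddCommGroup V] [Module ℂ V]
    {P : V → ℂ} (hP : P ∈ polyFuns V) {x : V} (hx : ∀ v, P (v - x) = P v) (v : V) (t : ℂ) :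
    P (v + t • x) = P v := by
  obtain ⟨p, hp⟩ := exists_polynomial_eval_line hP v x
  have hn : ∀ n : ℕ, p.eval (n : ℂ) = P v := by
    intro n
    rw [← hp]
    induction n with
    | zero => simp
    | succ n ih =>
      rw [← hx, ← ih]
      congr 1
      push_cast
      module
  have hpc : p = Polynomial.C (P v) := by
    refine Polynomial.eq_of_infinite_eval_eq _ _
      ((Set.infinite_range_of_injective (Nat.cast_injective (R := ℂ))).mono ?_)
    rintro _ ⟨n, rfl⟩
    simp [hn]
  rw [hp, hpc, Polynomial.eval_C]

/-- The projection of `V` onto `ker μ` along the line spanned by `l₀`. -/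
noncomputable def kerProj {V : Type*} [AddCommGroup V] [Module ℂ V] (μ : V →ₗ[ℂ] ℂ) (l₀ : V)
    (hl₀ : μ l₀ ≠ 0) : V →ₗ[ℂ] LinearMap.ker μ :=
  (LinearMap.id - (μ.smulRight ((μ l₀)⁻¹ • l₀))).codRestrict (LinearMap.ker μ) fun v => by
    simp [hl₀]

theorem coe_kerProj {V : Type*} [AddCommGroup V] [Module ℂ V] (μ : V →ₗ[ℂ] ℂ) (l₀ : V)
    (hl₀ : μ l₀ ≠ 0) (v : V) :
    (kerProj μ l₀ hl₀ v : V) = v - μ v • (μ l₀)⁻¹ • l₀ := rfl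

/-- The restriction map `P ↦ P|_M` is a bijection from
`ℂ[V]^{W₀,τ}` onto `ℂ[M]^{W₀}`, the algebra of `W₀`-invariant polynomial functions on
`M = ker μ` (note that `W₀` preserves `M` since `μ∘w = μ` for all `w ∈ W₀`). -/
theorem stmt_14 {V : Type*} [AddCommGroup V] [Module ℂ V] [FiniteDimensional ℂ V]
    (μ : V →ₗ[ℂ] ℂ) (hμ : μ ≠ 0) (l₀ : V) (hl₀ : μ l₀ ≠ 0)
    (W₀ : Subgroup (Module.End ℂ V)ˣ) [Finite W₀]
    (hWμ : ∀ w ∈ W₀, ∀ v : V, μ (((w : (Module.End ℂ V)ˣ) : Module.End ℂ V) v) = μ v)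
    (hWl : ∀ w ∈ W₀, ((w : (Module.End ℂ V)ˣ) : Module.End ℂ V) l₀ = l₀) :
    Set.BijOn (fun (P : V → ℂ) (m : ↥(LinearMap.ker μ)) => P ↑m)
      (tauInvPolyFuns W₀ l₀)
      {Q : ↥(LinearMap.ker μ) → ℂ | Q ∈ polyFuns ↥(LinearMap.ker μ) ∧
        ∀ w, ∀ hw : w ∈ W₀, ∀ m : ↥(LinearMap.ker μ),
          Q ⟨((w⁻¹ : (Module.End ℂ V)ˣ) : Module.End ℂ V) ↑m,
              LinearMap.mem_ker.mpr
                (by rw [hWμ w⁻¹ (W₀.inv_mem hw) (↑m : V)]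
                    exact LinearMap.mem_ker.mp m.2)⟩ = Q m} := by
  refine ⟨?_, ?_, ?_⟩
  · rintro P ⟨⟨hP, hW⟩, -⟩
    exact ⟨polyFuns_comp_linearMap (LinearMap.ker μ).subtype hP, fun w hw m => hW w hw m⟩
  · rintro P ⟨⟨hP, -⟩, hPτ⟩ Q ⟨⟨hQ, -⟩, hQτ⟩ hPQ
    funext v
    have hv : v = (kerProj μ l₀ hl₀ v : V) + (μ v * (μ l₀)⁻¹) • l₀ := by
      rw [coe_kerProj]
      module
    rw [hv, polyFuns_add_smul_of_sub_invariant hP hPτ, polyFuns_add_smul_of_sub_invariant hQ hQτ]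
    exact congrFun hPQ (kerProj μ l₀ hl₀ v)
  · rintro Q ⟨hQ, hW⟩
    refine ⟨Q ∘ kerProj μ l₀ hl₀, ⟨⟨polyFuns_comp_linearMap _ hQ, fun w hw v => ?_⟩,
      fun v => ?_⟩, ?_⟩
    · rw [Function.comp_apply, Function.comp_apply, ← hW w hw (kerProj μ l₀ hl₀ v)]
      refine congrArg Q (Subtype.ext ?_)
      simp only [coe_kerProj, map_sub, map_smul, hWμ w⁻¹ (W₀.inv_mem hw),
        hWl w⁻¹ (W₀.inv_mem hw)]
    · refine congrArg Q (Subtype.ext ?_)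
      simp [coe_kerProj, smul_smul, hl₀]
    · funext m
      refine congrArg Q (Subtype.ext ?_)
      simp [coe_kerProj]

end PolyFunStmt
end

section
/- Every P ∈ ℂ[V]^{W₀} can be written uniquely as a finite sum P = Σ_{i=0}^{p} α_i · μ^i with coefficients α_i ∈ ℂ[V]^{W₀,τ}; uniqueness means that if Σ_i α_i μ^i = Σ_i α'_i μ^i with all α_i, α'_i ∈ ℂ[V]^{W₀,τ}, then α_i = α'_i for all i. -/
namespace PolyFunStmt

variable (V : Type*) [AddCommGroup V] [Module ℂ V]

variable {V}

/-- The subalgebra of polynomial functions invariant under translation by `l₀`. -/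
noncomputable def translationInvPolyFuns (l₀ : V) : Subalgebra ℂ (V → ℂ) where
  carrier := {P | P ∈ polyFuns V ∧ ∀ v, P (v - l₀) = P v}
  mul_mem' ha hb := ⟨mul_mem ha.1 hb.1, fun v => by simp [ha.2 v, hb.2 v]⟩
  add_mem' ha hb := ⟨add_mem ha.1 hb.1, fun v => by simp [ha.2 v, hb.2 v]⟩
  algebraMap_mem' r := ⟨algebraMap_mem _ r, fun _ => rfl⟩

theorem linearForm_mem_polyFuns (φ : V →ₗ[ℂ] ℂ) : (⇑φ : V → ℂ) ∈ polyFuns V :=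
  Algebra.subset_adjoin ⟨φ, rfl⟩

theorem exists_aeval_eq_of_mem_polyFuns {μ : V →ₗ[ℂ] ℂ} {l₀ : V} (hl₀ : μ l₀ ≠ 0)
    {P : V → ℂ} (hP : P ∈ polyFuns V) :
    ∃ q : Polynomial (translationInvPolyFuns l₀), Polynomial.aeval (⇑μ : V → ℂ) q = P := by
  induction hP using Algebra.adjoin_induction with
  | mem f hf =>
    obtain ⟨φ, rfl⟩ := hf
    let ψ : V →ₗ[ℂ] ℂ := φ - (φ l₀ / μ l₀) • μ
    have hψ : (⇑ψ : V → ℂ) ∈ translationInvPolyFuns l₀ := by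
      refine ⟨linearForm_mem_polyFuns ψ, fun v => ?_⟩
      simp only [ψ, map_sub, LinearMap.sub_apply, LinearMap.smul_apply, smul_eq_mul]
      field_simp
      ring
    refine ⟨Polynomial.C ⟨_, hψ⟩ +
      Polynomial.C (algebraMap ℂ _ (φ l₀ / μ l₀)) * Polynomial.X, ?_⟩
    ext v
    simp [ψ]
  | algebraMap r =>
    exact ⟨Polynomial.C (algebraMap ℂ _ r), by simp⟩
  | add f g _ _ hf hg =>
    obtain ⟨p, rfl⟩ := hf
    obtain ⟨q, rfl⟩ := hg
    exact ⟨p + q, map_add _ p q⟩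
  | mul f g _ _ hf hg =>
    obtain ⟨p, rfl⟩ := hf
    obtain ⟨q, rfl⟩ := hg
    exact ⟨p * q, map_mul _ p q⟩

/-- Expansions in powers of `μ` with coefficients invariant under translation by `l₀`
are unique, even for arbitrary functions as coefficients. -/
theorem coeff_eq_of_sum_mul_pow_eq {μ : V →ₗ[ℂ] ℂ} {l₀ : V} (hl₀ : μ l₀ ≠ 0) {N : ℕ}
    {α β : ℕ → V → ℂ} (hα : ∀ i v, α i (v - l₀) = α i v) (hβ : ∀ i v, β i (v - l₀) = β i v)
    (h : ∑ i ∈ Finset.range N, α i * (⇑μ : V → ℂ) ^ i =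
      ∑ i ∈ Finset.range N, β i * (⇑μ : V → ℂ) ^ i) {i : ℕ} (hi : i < N) : α i = β i := by
  have translate {f : V → ℂ} (hf : ∀ v, f (v - l₀) = f v) (v : V) (n : ℕ) :
      f (v - n • l₀) = f v := by
    induction n with
    | zero => simp
    | succ n ih => rw [succ_nsmul, ← sub_sub, hf, ih]
  funext v
  let p : Polynomial ℂ :=
    ∑ j ∈ Finset.range N, Polynomial.C (α j v - β j v) * Polynomial.X ^ j
  have hp : p = 0 := by
    apply Polynomial.eq_zero_of_infinite_isRoot
    refine (Set.infinite_range_of_injective (f := fun n : ℕ => μ (v - n • l₀)) ?_).mono ?_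
    · intro m n hmn
      simpa [hl₀] using hmn
    · rintro _ ⟨n, rfl⟩
      have := congrFun h (v - n • l₀)
      simp only [Finset.sum_apply, Pi.mul_apply, Pi.pow_apply, translate (hα _),
        translate (hβ _)] at this
      simp only [Set.mem_ofPred_eq, Polynomial.IsRoot.def, p, Polynomial.eval_finsetSum,
        Polynomial.eval_mul, Polynomial.eval_C, Polynomial.eval_pow, Polynomial.eval_X,
        sub_mul, Finset.sum_sub_distrib, this, sub_self]
  have hc := congrArg (Polynomial.coeff · i) hp
  simpa [-map_sub, p, Polynomial.finsetSum_coeff, Polynomial.coeff_C_mul, Polynomial.coeff_X_pow, hi,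
    sub_eq_zero] using hc

/-- Every `P ∈ ℂ[V]^{W₀}` can be written as a finite sum
`P = Σ_{i=0}^{p} α_i·μ^i` with all `α_i ∈ ℂ[V]^{W₀,τ}`, and such an expression is
unique: if `Σ_{i<N} α_i μ^i = Σ_{i<N} α'_i μ^i` with all coefficients in
`ℂ[V]^{W₀,τ}`, then `α_i = α'_i` for all `i < N`. -/
theorem stmt_15 {V : Type*} [AddCommGroup V] [Module ℂ V] [FiniteDimensional ℂ V]
    (μ : V →ₗ[ℂ] ℂ) (hμ : μ ≠ 0) (l₀ : V) (hl₀ : μ l₀ ≠ 0)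
    (W₀ : Subgroup (Module.End ℂ V)ˣ) [Finite W₀]
    (hWμ : ∀ w ∈ W₀, ∀ v : V, μ (((w : (Module.End ℂ V)ˣ) : Module.End ℂ V) v) = μ v)
    (hWl : ∀ w ∈ W₀, ((w : (Module.End ℂ V)ˣ) : Module.End ℂ V) l₀ = l₀) :
    (∀ P ∈ invPolyFuns W₀,
      ∃ (p : ℕ) (α : ℕ → (V → ℂ)), (∀ i, α i ∈ tauInvPolyFuns W₀ l₀) ∧
        P = ∑ i ∈ Finset.range (p + 1), α i * (⇑μ : V → ℂ) ^ i) ∧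
    (∀ (N : ℕ) (α α' : ℕ → (V → ℂ)),
      (∀ i, α i ∈ tauInvPolyFuns W₀ l₀) → (∀ i, α' i ∈ tauInvPolyFuns W₀ l₀) →
      (∑ i ∈ Finset.range N, α i * (⇑μ : V → ℂ) ^ i) =
        (∑ i ∈ Finset.range N, α' i * (⇑μ : V → ℂ) ^ i) →
      ∀ i < N, α i = α' i) := by
  refine ⟨fun P hP => ?_, fun N α α' hα hα' h i hi =>
    coeff_eq_of_sum_mul_pow_eq hl₀ (fun i => (hα i).2) (fun i => (hα' i).2) h hi⟩
  obtain ⟨q, rfl⟩ := exists_aeval_eq_of_mem_polyFuns hl₀ hP.1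
  have hq : Polynomial.aeval (⇑μ : V → ℂ) q =
      ∑ i ∈ Finset.range (q.natDegree + 1), (q.coeff i : V → ℂ) * (⇑μ : V → ℂ) ^ i :=
    Polynomial.aeval_eq_sum_range _
  refine ⟨q.natDegree, fun i => q.coeff i,
    fun i => ⟨⟨(q.coeff i).2.1, fun w hw v => ?_⟩, (q.coeff i).2.2⟩, hq⟩
  rcases lt_or_ge i (q.natDegree + 1) with hi | hi
  · refine congrFun (coeff_eq_of_sum_mul_pow_eq hl₀
      (α := fun i v => (q.coeff i : V → ℂ) (((w⁻¹ : (Module.End ℂ V)ˣ) : Module.End ℂ V) v))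
      (β := fun i => q.coeff i) (fun i v => ?_) (fun i => (q.coeff i).2.2) ?_ hi) v
    · simp only [map_sub, hWl _ (inv_mem hw), (q.coeff i).2.2]
    · funext v
      have := hP.2 w hw v
      rw [hq] at this
      simpa [Finset.sum_apply, hWμ _ (inv_mem hw)] using this
  · simp [Polynomial.coeff_eq_zero_of_natDegree_lt (show q.natDegree < i from hi)]

end PolyFunStmt
end

section
/- Let B be a ℂ-subalgebra of ℂ[a₀,a₁,…,a_r] which is stable under τ and under τ⁻¹, and suppose there exist d₀ ∈ ℂ with d₀ ≠ 0 and a polynomial q ∈ ℂ[a₁,…,a_r] such that σ₁ := d₀·a₀ + q belongs to B. Then every τ-invariant ideal I of B (an ideal with τ(I) = I) is generated, as an ideal of B, by its τ-invariant elements; and if moreover B is a noetherian ring, then I is generated by finitely many τ-invariant elements. -/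
namespace TauIdealStmt

/-- The `ℂ`-algebra automorphism `τ` of `ℂ[a₀,a₁,…,a_r]` determined by
`τ(a₀) = a₀ − 1` and `τ(a_i) = a_i` for `i ≥ 1`. -/
noncomputable def tau (r : ℕ) :
    MvPolynomial (Fin (r + 1)) ℂ →ₐ[ℂ] MvPolynomial (Fin (r + 1)) ℂ :=
  MvPolynomial.aeval fun i =>
    if i = 0 then MvPolynomial.X 0 - 1 else MvPolynomial.X i

/-- The inverse automorphism `τ⁻¹`, determined by `τ⁻¹(a₀) = a₀ + 1` and
`τ⁻¹(a_i) = a_i` for `i ≥ 1`. -/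
noncomputable def tauInv (r : ℕ) :
    MvPolynomial (Fin (r + 1)) ℂ →ₐ[ℂ] MvPolynomial (Fin (r + 1)) ℂ :=
  MvPolynomial.aeval fun i =>
    if i = 0 then MvPolynomial.X 0 + 1 else MvPolynomial.X i

section DifferenceOperator

variable {R : Type*} [CommRing R] [Algebra ℂ R]

/-- The difference operator `φ - 1` of an algebra endomorphism `φ`. -/
noncomputable def diffOp (φ : R →ₐ[ℂ] R) : Module.End ℂ R := φ.toLinearMap - 1

theorem diffOp_apply (φ : R →ₐ[ℂ] R) (x : R) : diffOp φ x = φ x - x := rfl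

theorem diffOp_eq_zero_iff (φ : R →ₐ[ℂ] R) (x : R) : diffOp φ x = 0 ↔ φ x = x :=
  sub_eq_zero

/-- The difference operator is linear over the invariants. -/
theorem diffOp_pow_mul_of_invariant (φ : R →ₐ[ℂ] R) {c : R} (hc : φ c = c) (n : ℕ) (x : R) :
    (diffOp φ ^ n) (c * x) = c * (diffOp φ ^ n) x := by
  induction n generalizing x with
  | zero => simp
  | succ n ih =>
    have h : diffOp φ (c * x) = c * diffOp φ x := by
      rw [diffOp_apply, diffOp_apply, map_mul, hc, mul_sub]
    rw [pow_succ, Module.End.mul_apply, Module.End.mul_apply, h, ih]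

theorem diffOp_pow_mul_eq_zero (φ : R →ₐ[ℂ] R) {u : R} (hu : φ u = u - 1) {n : ℕ} {x : R}
    (hx : (diffOp φ ^ n) x = 0) : (diffOp φ ^ (n + 1)) (x * u) = 0 := by
  induction n generalizing x with
  | zero =>
    have hx : x = 0 := hx
    simp [hx]
  | succ n ih =>
    have h : diffOp φ (x * u) = diffOp φ x * u - x - diffOp φ x := by
      rw [diffOp_apply, diffOp_apply, map_mul, hu]
      ring
    have hx' : (diffOp φ ^ n) (diffOp φ x) = 0 := by
      rwa [pow_succ, Module.End.mul_apply] at hx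
    have hx'' : (diffOp φ ^ (n + 1)) (diffOp φ x) = 0 := by
      rw [pow_succ', Module.End.mul_apply, hx', map_zero]
    rw [pow_succ, Module.End.mul_apply, h, map_sub, map_sub, ih hx', hx, hx'', sub_zero, sub_zero]

theorem diffOp_prod_range_succ (φ : R →ₐ[ℂ] R) {t : R} (ht : φ t = t + 1) (n : ℕ) :
    diffOp φ (∏ i ∈ Finset.range (n + 1), (t - i)) =
      ((n + 1 : ℕ) : ℂ) • ∏ i ∈ Finset.range n, (t - i) := by
  have h : φ (∏ i ∈ Finset.range (n + 1), (t - i)) =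
      (∏ i ∈ Finset.range n, (t - i)) * (t + 1) := by
    rw [map_prod, Finset.prod_range_succ']
    simp [ht]
  rw [diffOp_apply, h, Finset.prod_range_succ, Nat.cast_smul_eq_nsmul, nsmul_eq_mul]
  push_cast
  ring

theorem diffOp_pow_prod_range (φ : R →ₐ[ℂ] R) {t : R} (ht : φ t = t + 1) (n : ℕ) :
    (diffOp φ ^ n) (∏ i ∈ Finset.range n, (t - i)) = algebraMap ℂ R n.factorial := by
  induction n with
  | zero => simp
  | succ n ih =>
    rw [pow_succ, Module.End.mul_apply, diffOp_prod_range_succ φ ht, map_smul, ih,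
      Algebra.smul_def, ← map_mul, Nat.factorial_succ]
    push_cast
    rfl

theorem mem_span_invariants (φ : R →ₐ[ℂ] R) {t : R} (ht : φ t = t + 1) {I : Ideal R}
    (hI : ∀ x ∈ I, φ x ∈ I) {n : ℕ} {x : R} (hx : x ∈ I) (hn : (diffOp φ ^ n) x = 0) :
    x ∈ Ideal.span {y : R | y ∈ I ∧ φ y = y} := by
  induction n generalizing x with
  | zero =>
    have hn : x = 0 := hn
    simp [hn]
  | succ n ih =>
    have hmem : ∀ k : ℕ, (diffOp φ ^ k) x ∈ I := fun k => by
      induction k with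
      | zero => exact hx
      | succ k hk =>
        rw [pow_succ', Module.End.mul_apply, diffOp_apply]
        exact I.sub_mem (hI _ hk) hk
    set c := (diffOp φ ^ n) x with hc
    have hcI : c ∈ I := hmem n
    have hinv : φ c = c := by
      rwa [pow_succ', Module.End.mul_apply, diffOp_eq_zero_iff] at hn
    set e : R := ((n.factorial : ℂ)⁻¹) • ∏ i ∈ Finset.range n, (t - i) with he
    have he1 : (diffOp φ ^ n) e = 1 := by
      rw [he, map_smul, diffOp_pow_prod_range φ ht, Algebra.smul_def, ← map_mul,
        inv_mul_cancel₀ (Nat.cast_ne_zero.mpr n.factorial_ne_zero), map_one]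
    have hcJ : c * e ∈ Ideal.span {y : R | y ∈ I ∧ φ y = y} :=
      Ideal.mul_mem_right _ _ (Ideal.subset_span ⟨hcI, hinv⟩)
    have hrest : x - c * e ∈ Ideal.span {y : R | y ∈ I ∧ φ y = y} := by
      refine ih (I.sub_mem hx (I.mul_mem_right _ hcI)) ?_
      rw [map_sub, diffOp_pow_mul_of_invariant φ hinv, he1, mul_one, ← hc, sub_self]
    simpa using Ideal.add_mem _ hrest hcJ

end DifferenceOperator

theorem tau_X_zero (r : ℕ) : tau r (MvPolynomial.X 0) = MvPolynomial.X 0 - 1 := by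
  simp [tau]

theorem tau_X_of_ne_zero (r : ℕ) {i : Fin (r + 1)} (hi : i ≠ 0) :
    tau r (MvPolynomial.X i) = MvPolynomial.X i := by
  simp [tau, hi]

theorem tau_rename_succ (r : ℕ) (q : MvPolynomial (Fin r) ℂ) :
    tau r (MvPolynomial.rename Fin.succ q) = MvPolynomial.rename Fin.succ q := by
  have h : (tau r).comp (MvPolynomial.rename Fin.succ) = MvPolynomial.rename Fin.succ := by
    refine MvPolynomial.algHom_ext fun i => ?_
    rw [AlgHom.comp_apply, MvPolynomial.rename_X, tau_X_of_ne_zero r (Fin.succ_ne_zero i)]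
  exact DFunLike.congr_fun h q

/-- The normalization `-σ₁ / d₀` is shifted by one under `τ`. -/
theorem tau_smul_eq_add_one (r : ℕ) {d₀ : ℂ} (hd₀ : d₀ ≠ 0) (q : MvPolynomial (Fin r) ℂ) :
    tau r ((-d₀⁻¹) • (MvPolynomial.C d₀ * MvPolynomial.X 0 + MvPolynomial.rename Fin.succ q)) =
      (-d₀⁻¹) • (MvPolynomial.C d₀ * MvPolynomial.X 0 + MvPolynomial.rename Fin.succ q) + 1 := by
  have hC : tau r (MvPolynomial.C d₀) = MvPolynomial.C d₀ := (tau r).commutes d₀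
  have hinv : (MvPolynomial.C d₀⁻¹ * MvPolynomial.C d₀ : MvPolynomial (Fin (r + 1)) ℂ) = 1 := by
    rw [← map_mul, inv_mul_cancel₀ hd₀, map_one]
  rw [map_smul, map_add, map_mul, hC, tau_X_zero, tau_rename_succ, MvPolynomial.smul_eq_C_mul,
    MvPolynomial.smul_eq_C_mul, map_neg]
  linear_combination hinv

theorem exists_diffOp_tau_pow_eq_zero (r : ℕ) (p : MvPolynomial (Fin (r + 1)) ℂ) :
    ∃ n, (diffOp (tau r) ^ n) p = 0 := by
  induction p using MvPolynomial.induction_on with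
  | C a =>
    refine ⟨1, ?_⟩
    rw [pow_one, diffOp_eq_zero_iff]
    exact (tau r).commutes a
  | add p q hp hq =>
    obtain ⟨m, hm⟩ := hp
    obtain ⟨n, hn⟩ := hq
    refine ⟨m + n, ?_⟩
    rw [map_add]
    nth_rw 1 [add_comm m n]
    rw [pow_add, pow_add, Module.End.mul_apply, Module.End.mul_apply, hm, hn, map_zero,
      map_zero, add_zero]
  | mul_X p i hp =>
    obtain ⟨n, hn⟩ := hp
    by_cases hi : i = 0
    · subst hi
      exact ⟨n + 1, diffOp_pow_mul_eq_zero _ (tau_X_zero r) hn⟩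
    · refine ⟨n, ?_⟩
      rw [mul_comm, diffOp_pow_mul_of_invariant _ (tau_X_of_ne_zero r hi), hn, mul_zero]

/-- The restriction of `τ` to a `τ`-stable subalgebra. -/
noncomputable def tauRestrict (r : ℕ) (B : Subalgebra ℂ (MvPolynomial (Fin (r + 1)) ℂ))
    (hB : ∀ p ∈ B, tau r p ∈ B) : B →ₐ[ℂ] B :=
  ((tau r).comp B.val).codRestrict B fun x => hB x x.2

theorem coe_diffOp_tauRestrict_pow (r : ℕ) (B : Subalgebra ℂ (MvPolynomial (Fin (r + 1)) ℂ))
    (hB : ∀ p ∈ B, tau r p ∈ B) (n : ℕ) (x : B) :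
    (((diffOp (tauRestrict r B hB) ^ n) x : B) : MvPolynomial (Fin (r + 1)) ℂ) =
      (diffOp (tau r) ^ n) (x : MvPolynomial (Fin (r + 1)) ℂ) := by
  induction n with
  | zero => rfl
  | succ n ih =>
    rw [pow_succ', pow_succ', Module.End.mul_apply, Module.End.mul_apply, ← ih]
    rfl

/-- Let `B ⊆ ℂ[a₀,…,a_r]` be a `ℂ`-subalgebra stable under `τ` and
`τ⁻¹`, containing `σ₁ = d₀·a₀ + q` with `d₀ ≠ 0` and `q ∈ ℂ[a₁,…,a_r]`.  Then every
`τ`-invariant ideal `I` of `B` is generated, as an ideal of `B`, by its `τ`-invariant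
elements; if moreover `B` is noetherian, by finitely many `τ`-invariant elements. -/
theorem stmt_16 (r : ℕ) (B : Subalgebra ℂ (MvPolynomial (Fin (r + 1)) ℂ))
    (hBτ : ∀ p ∈ B, tau r p ∈ B) (hBτ' : ∀ p ∈ B, tauInv r p ∈ B)
    (d₀ : ℂ) (hd₀ : d₀ ≠ 0) (q : MvPolynomial (Fin r) ℂ)
    (hσ : MvPolynomial.C d₀ * MvPolynomial.X 0 + MvPolynomial.rename Fin.succ q ∈ B)
    (I : Ideal B)
    (hI : ∀ x : B, x ∈ I ↔ (⟨tau r ↑x, hBτ ↑x x.2⟩ : B) ∈ I) :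
    I = Ideal.span {x : B | x ∈ I ∧ tau r ↑x = ↑x} ∧
    (IsNoetherianRing B →
      ∃ s : Finset B, (∀ x ∈ s, x ∈ I ∧ tau r ↑x = ↑x) ∧ I = Ideal.span ↑s) := by
  let φ := tauRestrict r B hBτ
  let t : B := (-d₀⁻¹) • ⟨_, hσ⟩
  have ht : φ t = t + 1 := Subtype.ext (tau_smul_eq_add_one r hd₀ q)
  have hspan : I = Ideal.span {x : B | x ∈ I ∧ tau r ↑x = ↑x} := by
    refine le_antisymm (fun x hx => ?_) (Ideal.span_le.mpr fun x hx => hx.1)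
    obtain ⟨n, hn⟩ := exists_diffOp_tau_pow_eq_zero r x
    have hn' : (diffOp φ ^ n) x = 0 :=
      Subtype.ext ((coe_diffOp_tauRestrict_pow r B hBτ n x).trans hn)
    refine Ideal.span_mono ?_ (mem_span_invariants φ ht (fun y hy => (hI y).mp hy) hx hn')
    exact fun y hy => ⟨hy.1, congrArg Subtype.val hy.2⟩
  refine ⟨hspan, fun hN => ?_⟩
  have hfg : (Submodule.span B {x : B | x ∈ I ∧ tau r ↑x = ↑x}).FG :=
    IsNoetherian.noetherian _
  obtain ⟨s, hs, hs'⟩ := Submodule.fg_span_iff_fg_span_finset_subset _ |>.mp hfg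
  exact ⟨s, fun x hx => hs hx, hspan.trans hs'⟩

end TauIdealStmt
end
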